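/- Let W, Δ ∈ ℝ^{N×N} be symmetric matrices with all entries nonnegative, let L = D_W − W be the combinatorial Laplacian of W, and for Y ∈ ℝ^{N×d} define B(Y) ∈ ℝ^{N×N} by B(Y)_{i,j} = −W_{i,j}·Δ_{i,j}/‖Y_i − Y_j‖ if i ≠ j and ‖Y_i − Y_j‖ ≠ 0, B(Y)_{i,j} = 0 if i ≠ j and ‖Y_i − Y_j‖ = 0, and B(Y)_{i,i} = −Σ_{k≠i} B(Y)_{i,k}. Defining the raw stress σ(X) = Σ_{1 ≤ i < j ≤ N} W_{i,j}·(Δ_{i,j} − ‖X_i − X_j‖)², one has, for all X, Y ∈ ℝ^{N×d}, the majorization inequality σ(X) ≤ Σ_{1 ≤ i < j ≤ N} W_{i,j}·Δ_{i,j}² + trace(X^⊤·L·X) − 2·trace(X^⊤·B(Y)·Y). -/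

import Mathlib

open Matrix Finset

/-- Euclidean distance between rows `i` and `j` of `X`. -/
noncomputable def rowDist {I : Type*} {d : ℕ} (X : Matrix I (Fin d) ℝ) (i j : I) : ℝ :=
  Real.sqrt (∑ c : Fin d, (X i c - X j c) ^ 2)

theorem sum_sum_eq_two_mul_sum_lt {N : ℕ} (f : Fin N → Fin N → ℝ)
    (hf : ∀ i j, f i j = f j i) (hd : ∀ i, f i i = 0) :
    ∑ i, ∑ j, f i j = 2 * ∑ i, ∑ j, if i < j then f i j else 0 := by
  have key : ∀ i j, f i j = (if i < j then f i j else 0) + (if j < i then f j i else 0) := by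
    intro i j
    rcases lt_trichotomy i j with h | h | h
    · simp [h, h.not_gt]
    · simp [h, hd]
    · simp [h, h.not_gt, hf i j]
  calc ∑ i, ∑ j, f i j
      = ∑ i, ∑ j, ((if i < j then f i j else 0) + (if j < i then f j i else 0)) :=
        sum_congr rfl fun i _ => sum_congr rfl fun j _ => key i j
    _ = 2 * ∑ i, ∑ j, if i < j then f i j else 0 := by
        simp only [sum_add_distrib]
        rw [sum_comm (f := fun i j => if j < i then f j i else 0), two_mul]

/-- Bilinear form of a symmetric matrix with zero row sums, as a sum over pairs. -/
theorem trace_transpose_mul_mul_eq_sum_lt {N d : ℕ} (M : Matrix (Fin N) (Fin N) ℝ)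
    (hM : ∀ i j, M i j = M j i) (hrow : ∀ i, ∑ j, M i j = 0)
    (X Y : Matrix (Fin N) (Fin d) ℝ) :
    trace (Xᵀ * M * Y) = ∑ i, ∑ j, if i < j then
      -M i j * ∑ c, (X i c - X j c) * (Y i c - Y j c) else 0 := by
  have hsum := sum_sum_eq_two_mul_sum_lt
    (fun i j => -M i j * ∑ c, (X i c - X j c) * (Y i c - Y j c))
    (fun i j => by
      rw [hM i j]
      congr 1
      exact sum_congr rfl fun c _ => by ring)
    (fun i => by simp)
  have htr : trace (Xᵀ * M * Y) = ∑ i, ∑ j, M i j * ∑ c, X i c * Y j c := by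
    simp only [trace, diag_apply, mul_apply, transpose_apply, sum_mul, mul_sum]
    rw [sum_comm, sum_congr rfl fun j _ => sum_comm, sum_comm]
    exact sum_congr rfl fun i _ => sum_congr rfl fun j _ => sum_congr rfl fun c _ => by ring
  have hleft : ∑ i, ∑ j, M i j * ∑ c, X i c * Y i c = 0 := by
    simp [← sum_mul, hrow]
  have hright : ∑ i, ∑ j, M i j * ∑ c, X j c * Y j c = 0 := by
    rw [sum_comm]
    simp [hM _, ← sum_mul, hrow]
  have hswap : ∑ i, ∑ j, M i j * ∑ c, X j c * Y i c =
      ∑ i, ∑ j, M i j * ∑ c, X i c * Y j c := by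
    rw [sum_comm]
    exact sum_congr rfl fun i _ => sum_congr rfl fun j _ => by rw [hM j i]
  have hexp : ∑ i, ∑ j, -M i j * ∑ c, (X i c - X j c) * (Y i c - Y j c) =
      (∑ i, ∑ j, M i j * ∑ c, X i c * Y j c) + (∑ i, ∑ j, M i j * ∑ c, X j c * Y i c) -
      (∑ i, ∑ j, M i j * ∑ c, X i c * Y i c) - ∑ i, ∑ j, M i j * ∑ c, X j c * Y j c := by
    simp only [← sum_add_distrib, ← sum_sub_distrib, mul_sum]
    exact sum_congr rfl fun i _ => sum_congr rfl fun j _ => sum_congr rfl fun c _ => by ring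
  linarith

theorem rowDist_comm {I : Type*} {d : ℕ} (X : Matrix I (Fin d) ℝ) (i j : I) :
    rowDist X i j = rowDist X j i := by
  unfold rowDist
  congr 1
  exact sum_congr rfl fun c _ => by ring

theorem rowDist_sq {I : Type*} {d : ℕ} (X : Matrix I (Fin d) ℝ) (i j : I) :
    rowDist X i j ^ 2 = ∑ c, (X i c - X j c) ^ 2 :=
  Real.sq_sqrt (sum_nonneg fun _ _ => sq_nonneg _)

theorem sum_mul_le_rowDist_mul_rowDist {I : Type*} {d : ℕ} (X Y : Matrix I (Fin d) ℝ)
    (i j : I) :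
    ∑ c, (X i c - X j c) * (Y i c - Y j c) ≤ rowDist X i j * rowDist Y i j :=
  Real.sum_mul_le_sqrt_mul_sqrt _ _ _

/-- the SMACOF majorization inequality:
`σ(X) ≤ Σ_{i<j} W_{i,j}·Δ_{i,j}² + tr(Xᵀ·L·X) − 2·tr(Xᵀ·B(Y)·Y)`. -/
theorem stmt_13 (N d : ℕ)
    (W Δ : Matrix (Fin N) (Fin N) ℝ) (hWsym : W.IsSymm) (hΔsym : Δ.IsSymm)
    (hWpos : ∀ i j, 0 ≤ W i j) (hΔpos : ∀ i j, 0 ≤ Δ i j)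
    (L : Matrix (Fin N) (Fin N) ℝ)
    (hL : L = Matrix.diagonal (fun i => ∑ j, W i j) - W)
    (X Y : Matrix (Fin N) (Fin d) ℝ)
    (B : Matrix (Fin N) (Fin N) ℝ)
    (hBoff : ∀ i j, i ≠ j → B i j =
      if rowDist Y i j ≠ 0 then -(W i j * Δ i j) / rowDist Y i j else 0)
    (hBdiag : ∀ i, B i i = -∑ k ∈ univ.erase i, B i k) :
    (∑ i : Fin N, ∑ j : Fin N,
      if i < j then W i j * (Δ i j - rowDist X i j) ^ 2 else 0) ≤
    (∑ i : Fin N, ∑ j : Fin N, if i < j then W i j * (Δ i j) ^ 2 else 0) +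
      Matrix.trace (Xᵀ * L * X) - 2 * Matrix.trace (Xᵀ * B * Y) := by
  have hW : ∀ i j, W i j = W j i := fun i j => hWsym.apply j i
  have hΔ : ∀ i j, Δ i j = Δ j i := fun i j => hΔsym.apply j i
  have hLoff : ∀ i j, i ≠ j → L i j = -W i j := by
    intro i j hij
    simp [hL, hij]
  have hLsymm : ∀ i j, L i j = L j i := by
    intro i j
    rcases eq_or_ne i j with rfl | hij
    · rfl
    · rw [hLoff i j hij, hLoff j i hij.symm, hW]
  have hLrow : ∀ i, ∑ j, L i j = 0 := by
    intro i
    simp [hL, diagonal_apply]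
  have hBsymm : ∀ i j, B i j = B j i := by
    intro i j
    rcases eq_or_ne i j with rfl | hij
    · rfl
    · rw [hBoff i j hij, hBoff j i hij.symm, hW, hΔ, rowDist_comm]
  have hBrow : ∀ i, ∑ j, B i j = 0 := by
    intro i
    rw [← add_sum_erase univ _ (mem_univ i), hBdiag, neg_add_cancel]
  rw [trace_transpose_mul_mul_eq_sum_lt L hLsymm hLrow,
    trace_transpose_mul_mul_eq_sum_lt B hBsymm hBrow]
  simp only [mul_sum (s := (univ : Finset (Fin N))), ← sum_add_distrib, ← sum_sub_distrib]
  refine sum_le_sum fun i _ => sum_le_sum fun j _ => ?_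
  split_ifs with hij
  · have hcs := sum_mul_le_rowDist_mul_rowDist X Y i j
    have hX : 0 ≤ rowDist X i j := Real.sqrt_nonneg _
    have hWΔ : 0 ≤ W i j * Δ i j := mul_nonneg (hWpos i j) (hΔpos i j)
    have hBle : -B i j * ∑ c, (X i c - X j c) * (Y i c - Y j c) ≤
        W i j * Δ i j * rowDist X i j := by
      rw [hBoff i j hij.ne]
      split_ifs with hY
      · have hYpos : 0 < rowDist Y i j := lt_of_le_of_ne (Real.sqrt_nonneg _) (Ne.symm hY)
        rw [neg_div, neg_neg, div_mul_eq_mul_div, div_le_iff₀ hYpos, mul_assoc _ (rowDist X i j)]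
        exact mul_le_mul_of_nonneg_left hcs hWΔ
      · simpa using mul_nonneg hWΔ hX
    have hsq : ∑ c, (X i c - X j c) * (X i c - X j c) = rowDist X i j ^ 2 := by
      rw [rowDist_sq]
      exact sum_congr rfl fun c _ => (sq _).symm
    rw [hsq, hLoff i j hij.ne]
    linarith
  · simp
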